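/- Let M be a positive integer. The set U of univoque bases has no isolated points: for every q ∈ U and every ε > 0 there exists r ∈ U with r ≠ q and |r − q| < ε. Equivalently, the closure of U has no isolated points. -/

import Mathlib

open Set MeasureTheory Filter

noncomputable section

/-- The projection `π_q` of a digit sequence (0-indexed): `∑ d i / q^(i+1)`. -/
def piQ (q : ℝ) (d : ℕ → ℕ) : ℝ := ∑' i : ℕ, (d i : ℝ) / q ^ (i + 1)

/-- `d` is a `q`-expansion of `x` over the alphabet `{0,…,M}`. -/
def IsExpansion (M : ℕ) (q x : ℝ) (d : ℕ → ℕ) : Prop :=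
  (∀ i, d i ≤ M) ∧ piQ q d = x

/-- `U'_q`: digit sequences that are the unique `q`-expansion of their projection. -/
def UnivSeqs (M : ℕ) (q : ℝ) : Set (ℕ → ℕ) :=
  {d | (∀ i, d i ≤ M) ∧ ∀ e : ℕ → ℕ, IsExpansion M q (piQ q d) e → e = d}

/-- The set `U = U(M)` of univoque bases: `q ∈ (1, M+1]` such that `1` has a
unique `q`-expansion over `{0,…,M}`. -/
def UnivBases (M : ℕ) : Set ℝ :=
  {q | 1 < q ∧ q ≤ M + 1 ∧ ∃! d : ℕ → ℕ, IsExpansion M q 1 d}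

/-- The Komornik–Loreti constant `q'(M) = min U(M)`. -/
def KL (M : ℕ) : ℝ := sInf (UnivBases M)

/-- `(a, b)` is a connected component of `(q'(M), M+1) \ closure (U(M))`:
an open subinterval whose endpoints do not lie in that (open) set. -/
def CC (M : ℕ) (a b : ℝ) : Prop :=
  a < b ∧ Ioo a b ⊆ Ioo (KL M) (M + 1) \ closure (UnivBases M) ∧
    a ∉ Ioo (KL M) (M + 1) \ closure (UnivBases M) ∧
    b ∉ Ioo (KL M) (M + 1) \ closure (UnivBases M)

/-- `x ∈ [0, M/(q-1)]` has exactly two distinct `q`-expansions. -/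
def HasExactlyTwoExpansions (M : ℕ) (q x : ℝ) : Prop :=
  ∃ c d : ℕ → ℕ, c ≠ d ∧ IsExpansion M q x c ∧ IsExpansion M q x d ∧
    ∀ e : ℕ → ℕ, IsExpansion M q x e → e = c ∨ e = d

/-- `B_2(M)`: bases `q ∈ (1, M+1]` for which some `x ∈ [0, M/(q-1)]` has exactly
two `q`-expansions. -/
def B2 (M : ℕ) : Set ℝ :=
  {q | 1 < q ∧ q ≤ M + 1 ∧
    ∃ x ∈ Icc (0 : ℝ) (M / (q - 1)), HasExactlyTwoExpansions M q x}

/-- Strict lexicographic order on digit sequences. -/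
def seqLt (a b : ℕ → ℕ) : Prop := ∃ n, (∀ i < n, a i = b i) ∧ a n < b n

/-- Lexicographic order on digit sequences. -/
def seqLe (a b : ℕ → ℕ) : Prop := seqLt a b ∨ a = b

/-- A digit sequence is infinite if it does not end with `0^∞` after a last
nonzero digit (in particular `0^∞` is infinite). -/
def IsInfiniteSeq (a : ℕ → ℕ) : Prop := ¬∃ m, a m ≠ 0 ∧ ∀ i > m, a i = 0

/-- `a = α(q)`, the quasi-greedy `q`-expansion of `1`: the lexicographically
largest infinite `q`-expansion of `1`. -/
def IsQuasiGreedy (M : ℕ) (q : ℝ) (a : ℕ → ℕ) : Prop :=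
  IsExpansion M q 1 a ∧ IsInfiniteSeq a ∧
    ∀ b : ℕ → ℕ, IsExpansion M q 1 b → IsInfiniteSeq b → seqLe b a

/-- `b = β(q)`, the greedy `q`-expansion of `1`: the lexicographically largest
`q`-expansion of `1`. -/
def IsGreedy (M : ℕ) (q : ℝ) (b : ℕ → ℕ) : Prop :=
  IsExpansion M q 1 b ∧ ∀ c : ℕ → ℕ, IsExpansion M q 1 c → seqLe c b

/-- `w⁺`: increase the last digit of a word by one. -/
def plusWord : List ℕ → List ℕ
  | [] => []
  | [a] => [a + 1]
  | a :: b :: rest => a :: plusWord (b :: rest)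

/-- `w⁻`: decrease the last digit of a word by one. -/
def minusWord : List ℕ → List ℕ
  | [] => []
  | [a] => [a - 1]
  | a :: b :: rest => a :: minusWord (b :: rest)

/-- The reflection of a word: `\overline{w} = (M - w_1) ⋯ (M - w_k)`. -/
def reflWord (M : ℕ) (w : List ℕ) : List ℕ := w.map fun a => M - a

/-- The substitution `g(w) = w⁺ \overline{w⁺}`. -/
def gWord (M : ℕ) (w : List ℕ) : List ℕ := plusWord w ++ reflWord M (plusWord w)

/-- The periodic sequence `t^∞` determined by a word `t`. -/
def periodicSeq (t : List ℕ) (i : ℕ) : ℕ := t.getD (i % t.length) 0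

/-- Strict lexicographic order on words. -/
def wordLt (u v : List ℕ) : Prop := List.Lex (· < ·) u v

/-- Lexicographic order on words. -/
def wordLe (u v : List ℕ) : Prop := wordLt u v ∨ u = v

/-- The connected component `(q_0, q_0^*)` of `(q'(M), M+1) \ closure (U(M))` is
generated by the word `t`, and `θ = α(q_0^*)`: `α(q_0) = t^∞` and
`α(q_0^*) = lim_{n→∞} g^n(t)`, i.e. every `g^n(t)` is a prefix of `θ`. -/
def GeneratedBy (M : ℕ) (q₀ q₀star : ℝ) (t : List ℕ) (θ : ℕ → ℕ) : Prop :=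
  CC M q₀ q₀star ∧ t ≠ [] ∧ IsQuasiGreedy M q₀ (periodicSeq t) ∧
    IsQuasiGreedy M q₀star θ ∧
    ∀ n : ℕ, ∀ i < ((gWord M)^[n] t).length, ((gWord M)^[n] t).getD i 0 = θ i


/-! ### Values of bounded digit sequences -/

lemma summable_digits {q : ℝ} (hq : 1 < q) {B : ℕ} {a : ℕ → ℕ} (ha : ∀ i, a i ≤ B) :
    Summable fun i => (a i : ℝ) / q ^ (i + 1) := by
  have hq0 : 0 < q := by linarith
  have h1 : Summable fun i : ℕ => (B : ℝ) * (q⁻¹) ^ i :=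
    (summable_geometric_of_lt_one (by positivity) (inv_lt_one_of_one_lt₀ hq)).mul_left _
  refine Summable.of_nonneg_of_le (fun i => by positivity) (fun i => ?_) h1
  rw [inv_pow, ← div_eq_mul_inv]
  have h2 : (a i : ℝ) ≤ B := by exact_mod_cast ha i
  have h3 : q ^ i ≤ q ^ (i + 1) := pow_le_pow_right₀ hq.le (by omega)
  gcongr

lemma piQ_split {q : ℝ} (hq : 1 < q) {B : ℕ} {a : ℕ → ℕ} (ha : ∀ i, a i ≤ B) (j : ℕ) :
    piQ q a = ∑ i ∈ Finset.range j, (a i : ℝ) / q ^ (i + 1)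
      + piQ q (fun i => a (j + i)) / q ^ j := by
  have hq0 : 0 < q := by linarith
  unfold piQ
  rw [← (summable_digits hq ha).sum_add_tsum_nat_add j, ← tsum_div_const]
  congr 1
  refine tsum_congr fun i => ?_
  rw [div_div, ← pow_add, add_right_comm, add_comm i j]

lemma piQ_shift {q : ℝ} (hq : 1 < q) {B : ℕ} {a : ℕ → ℕ} (ha : ∀ i, a i ≤ B) (n : ℕ) :
    q * piQ q (fun i => a (n + i)) = a n + piQ q (fun i => a (n + 1 + i)) := by
  have hq0 : 0 < q := by linarith
  rw [piQ_split hq (a := fun i => a (n + i)) (fun i => ha _) 1]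
  simp only [Finset.sum_range_one, add_zero, zero_add, pow_one, ← add_assoc]
  field_simp

lemma piQ_first_diff {q : ℝ} (hq : 1 < q) {B : ℕ} {a b : ℕ → ℕ} (ha : ∀ i, a i ≤ B)
    (hb : ∀ i, b i ≤ B) {j : ℕ} (h : ∀ i < j, a i = b i) :
    q ^ (j + 1) * (piQ q a - piQ q b) =
      (a j - b j) + (piQ q (fun i => a (j + 1 + i)) - piQ q (fun i => b (j + 1 + i))) := by
  have hq0 : 0 < q := by linarith
  have hs : ∑ i ∈ Finset.range j, (a i : ℝ) / q ^ (i + 1)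
      = ∑ i ∈ Finset.range j, (b i : ℝ) / q ^ (i + 1) :=
    Finset.sum_congr rfl fun i hi => by rw [h i (Finset.mem_range.1 hi)]
  rw [piQ_split hq ha j, piQ_split hq hb j, hs]
  have h1 := piQ_shift hq ha j
  have h2 := piQ_shift hq hb j
  have h3 : q ^ j ≠ 0 := by positivity
  rw [pow_succ]
  field_simp
  linear_combination h1 - h2

lemma piQ_eq_of_remainders {q : ℝ} (hq : 1 < q) {c : ℕ → ℕ} {x : ℕ → ℝ} {B : ℝ}
    (hB : ∀ n, |x n| ≤ B) (h : ∀ n, q * x n = c n + x (n + 1)) : piQ q c = x 0 := by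
  have hq0 : 0 < q := by linarith
  refine HasSum.tsum_eq ((hasSum_iff_tendsto_nat_of_nonneg (fun i => by positivity) _).2 ?_)
  have hpart : ∀ n, ∑ i ∈ Finset.range n, (c i : ℝ) / q ^ (i + 1) = x 0 - x n / q ^ n := by
    intro n
    induction n with
    | zero => simp
    | succ n ih =>
      rw [Finset.sum_range_succ, ih, pow_succ]
      field_simp
      linear_combination -(h n)
  simp only [hpart]
  have hB0 : Tendsto (fun n : ℕ => B * (q⁻¹) ^ n) atTop (nhds 0) := by
    simpa using (tendsto_pow_atTop_nhds_zero_of_lt_one (by positivity)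
      (inv_lt_one_of_one_lt₀ hq)).const_mul B
  have hx : Tendsto (fun n : ℕ => x n / q ^ n) atTop (nhds 0) := by
    refine squeeze_zero_norm (fun n => ?_) hB0
    rw [Real.norm_eq_abs, abs_div, abs_of_pos (pow_pos hq0 n), inv_pow, ← div_eq_mul_inv]
    have := hB n
    gcongr
  simpa using hx.const_sub (x 0)

lemma piQ_const {q : ℝ} (hq : 1 < q) (M : ℕ) : piQ q (fun _ => M) = M / (q - 1) := by
  have : q - 1 ≠ 0 := by linarith
  exact piQ_eq_of_remainders hq (x := fun _ => (M : ℝ) / (q - 1)) (fun _ => le_rfl)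
    fun _ => by field_simp; ring

lemma piQ_compl {q : ℝ} (hq : 1 < q) {M : ℕ} {a : ℕ → ℕ} (ha : ∀ i, a i ≤ M) :
    piQ q (fun i => M - a i) = M / (q - 1) - piQ q a := by
  rw [← piQ_const hq]
  unfold piQ
  rw [← (summable_digits hq fun _ : ℕ => le_refl M).tsum_sub (summable_digits hq ha)]
  refine tsum_congr fun i => ?_
  rw [Nat.cast_sub (ha i), sub_div]

lemma piQ_nonneg {q : ℝ} (hq : 1 < q) (a : ℕ → ℕ) : 0 ≤ piQ q a :=
  tsum_nonneg fun i => by have : 0 < q := by linarith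
                          positivity

lemma piQ_le {q : ℝ} (hq : 1 < q) {M : ℕ} {a : ℕ → ℕ} (ha : ∀ i, a i ≤ M) :
    piQ q a ≤ M / (q - 1) := by
  have := piQ_compl hq ha
  linarith [piQ_nonneg hq fun i => M - a i]

lemma piQ_pos {q : ℝ} (hq : 1 < q) {B : ℕ} {a : ℕ → ℕ} (ha : ∀ i, a i ≤ B) {n : ℕ}
    (hn : 0 < a n) : 0 < piQ q a := by
  have hq0 : 0 < q := by linarith
  exact (summable_digits hq ha).tsum_pos (fun i => by positivity) n
    (by have : (0 : ℝ) < a n := by exact_mod_cast hn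
        positivity)

lemma piQ_lt_piQ {s q : ℝ} (hs : 1 < s) (hsq : s < q) {B : ℕ} {a : ℕ → ℕ} (ha : ∀ i, a i ≤ B)
    {n : ℕ} (hn : 0 < a n) : piQ q a < piQ s a := by
  have hs0 : 0 < s := by linarith
  have hn' : (0 : ℝ) < a n := by exact_mod_cast hn
  refine Summable.tsum_lt_tsum (i := n) (fun i => ?_) ?_ (summable_digits (hs.trans hsq) ha)
    (summable_digits hs ha)
  · gcongr
  · have : s ^ (n + 1) < q ^ (n + 1) := pow_lt_pow_left₀ hsq hs0.le (by omega)
    gcongr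

lemma continuousOn_piQ {s : ℝ} (hs : 1 < s) {B : ℕ} {a : ℕ → ℕ} (ha : ∀ i, a i ≤ B) :
    ContinuousOn (fun q => piQ q a) (Ici s) := by
  have hs0 : 0 < s := by linarith
  unfold piQ
  refine continuousOn_tsum (u := fun i => (a i : ℝ) / s ^ (i + 1)) (fun i => ?_)
    (summable_digits hs ha) fun i q hq => ?_
  · refine continuousOn_const.div (by fun_prop) fun q hq => ?_
    have : 0 < q := hs0.trans_le hq
    positivity
  · have hq' : s ≤ q := hq
    have : 0 < q := hs0.trans_le hq'
    rw [Real.norm_of_nonneg (by positivity)]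
    gcongr

lemma tendsto_piQ {q : ℝ} (hq : 1 < q) {B : ℕ} {e : ℕ → ℕ → ℕ} {d : ℕ → ℕ}
    (he : ∀ m i, e m i ≤ B) (h : ∀ m, ∀ i < m, e m i = d i) :
    Tendsto (fun m => piQ q (e m)) atTop (nhds (piQ q d)) := by
  have hq0 : 0 < q := by linarith
  refine tendsto_tsum_of_dominated_convergence (summable_digits hq fun _ : ℕ => le_refl B)
    (fun i => ?_) (Eventually.of_forall fun m i => ?_)
  · refine tendsto_const_nhds.congr' ?_
    filter_upwards [eventually_gt_atTop i] with m hm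
    rw [h m i hm]
  · rw [Real.norm_of_nonneg (by positivity)]
    have : (e m i : ℝ) ≤ B := by exact_mod_cast he m i
    gcongr

/-! ### Existence of expansions -/

lemma exists_digit {M : ℕ} {q x : ℝ} (hq : 1 < q) (hqM : q ≤ M + 1)
    (hx : x ∈ Icc 0 (M / (q - 1))) : ∃ c : ℕ, c ≤ M ∧ q * x - c ∈ Icc 0 (M / (q - 1)) := by
  have hq1 : 0 < q - 1 := by linarith
  have hL : 1 ≤ M / (q - 1) := by rw [le_div_iff₀ hq1]; linarith
  have hqx : 0 ≤ q * x := mul_nonneg (by linarith) hx.1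
  by_cases h : q * x < M
  · refine ⟨⌊q * x⌋₊, ?_, ?_, ?_⟩
    · exact_mod_cast (Nat.floor_le hqx).trans h.le
    · linarith [Nat.floor_le hqx]
    · linarith [Nat.lt_floor_add_one (q * x)]
  · refine ⟨M, le_rfl, by linarith, ?_⟩
    have h1 : q * x ≤ q * (M / (q - 1)) := by have := hx.2; gcongr
    have h2 : q * (M / (q - 1)) - M = M / (q - 1) := by field_simp; ring
    linarith

lemma exists_expansion {M : ℕ} {q x : ℝ} (hq : 1 < q) (hqM : q ≤ M + 1)
    (hx : x ∈ Icc 0 (M / (q - 1))) : ∃ c, IsExpansion M q x c := by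
  choose! f hfM hf using fun (y : ℝ) (hy : y ∈ Icc 0 (M / (q - 1))) => exists_digit hq hqM hy
  let y : ℕ → ℝ := fun n => (fun z => q * z - f z)^[n] x
  have hsucc : ∀ n, y (n + 1) = q * y n - f (y n) := fun n => Function.iterate_succ_apply' _ _ _
  have hy : ∀ n, y n ∈ Icc 0 (M / (q - 1)) := by
    intro n
    induction n with
    | zero => exact hx
    | succ n ih => rw [hsucc]; exact hf _ ih
  refine ⟨fun n => f (y n), fun n => hfM _ (hy n), ?_⟩
  refine piQ_eq_of_remainders hq (x := y) (B := M / (q - 1)) (fun n => ?_) fun n => ?_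
  · rw [abs_of_nonneg (hy n).1]; exact (hy n).2
  · rw [hsucc]; ring

/-! ### Lexicographic properties of unique expansions -/

/-- Changing the digit at `n` of an expansion and re-expanding the remainder. -/
lemma exists_expansion_of_changed_digit {M : ℕ} {q x : ℝ} (hq : 1 < q) (hqM : q ≤ M + 1)
    {d : ℕ → ℕ} (hd : IsExpansion M q x d) {n v : ℕ} (hv : v ≤ M)
    (h : (d n : ℝ) - v + piQ q (fun i => d (n + 1 + i)) ∈ Icc 0 (M / (q - 1))) :
    ∃ e, IsExpansion M q x e ∧ e n = v := by
  obtain ⟨c, hc, hcv⟩ := exists_expansion hq hqM h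
  let e : ℕ → ℕ := fun i => if i < n then d i else if i = n then v else c (i - (n + 1))
  have heM : ∀ i, e i ≤ M := by
    intro i
    have := hd.1 i
    have := hc (i - (n + 1))
    simp only [e]
    split_ifs <;> assumption
  have hen : e n = v := by simp [e]
  refine ⟨e, ⟨heM, ?_⟩, hen⟩
  have h1 := piQ_first_diff hq heM hd.1 (j := n) fun i hi => by simp [e, hi]
  have h2 : (fun i => e (n + 1 + i)) = c := by
    funext i
    have h3 : ¬ n + 1 + i < n := by omega
    have h4 : n + 1 + i ≠ n := by omega
    simp [e, h3, h4]
  rw [h2, hcv, hen, hd.2] at h1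
  have h5 : q ^ (n + 1) ≠ 0 := by have : 0 < q := by linarith
                                  positivity
  have h6 : q ^ (n + 1) * (piQ q e - x) = 0 := by rw [h1]; ring
  have := (mul_eq_zero.1 h6).resolve_left h5
  linarith

lemma tail_lt_one_of_lt {M : ℕ} {q : ℝ} (hq : 1 < q) (hqM : q ≤ M + 1) {d : ℕ → ℕ}
    (hd : IsExpansion M q 1 d) (huniq : ∀ e, IsExpansion M q 1 e → e = d) {n : ℕ}
    (hn : d n < M) : piQ q (fun i => d (n + 1 + i)) < 1 := by
  by_contra! hcon
  have hle := piQ_le hq (a := fun i => d (n + 1 + i)) fun i => hd.1 _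
  obtain ⟨e, he, hen⟩ := exists_expansion_of_changed_digit hq hqM hd (n := n) (v := d n + 1) hn
    ⟨by push_cast; linarith, by push_cast; linarith⟩
  rw [huniq e he] at hen
  omega

lemma compl_tail_lt_one_of_pos {M : ℕ} {q : ℝ} (hq : 1 < q) (hqM : q ≤ M + 1) {d : ℕ → ℕ}
    (hd : IsExpansion M q 1 d) (huniq : ∀ e, IsExpansion M q 1 e → e = d) {n : ℕ}
    (hn : 0 < d n) : piQ q (fun i => M - d (n + 1 + i)) < 1 := by
  by_contra! hcon
  rw [piQ_compl hq (a := fun i => d (n + 1 + i)) fun i => hd.1 _] at hcon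
  have h0 := piQ_nonneg hq fun i => d (n + 1 + i)
  have hnM := hd.1 n
  obtain ⟨e, he, hen⟩ := exists_expansion_of_changed_digit hq hqM hd (n := n) (v := d n - 1)
    (by omega) (by
      rw [Nat.cast_sub (by omega)]
      exact ⟨by push_cast; linarith, by push_cast; linarith⟩)
  rw [huniq e he] at hen
  omega

/-- A sequence lexicographically above the unique expansion of `1` has value above `1`. -/
lemma one_lt_piQ_of_lex_gt {M : ℕ} {q : ℝ} (hq : 1 < q) {a d : ℕ → ℕ} (ha : ∀ i, a i ≤ M)
    (hd : IsExpansion M q 1 d)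
    (htail : ∀ n, d n < M → piQ q (fun i => d (n + 1 + i)) < 1) {j : ℕ}
    (heq : ∀ i < j, a i = d i) (hlt : d j < a j) : 1 < piQ q a := by
  have h1 := piQ_first_diff hq ha hd.1 heq
  have h2 := htail j (hlt.trans_le (ha j))
  have h3 := piQ_nonneg hq fun i => a (j + 1 + i)
  have h4 : (d j : ℝ) + 1 ≤ a j := by exact_mod_cast hlt
  rw [hd.2] at h1
  have h5 : 0 < q ^ (j + 1) * (piQ q a - 1) := by rw [h1]; linarith
  have := pos_of_mul_pos_right h5 (by have : 0 < q := by linarith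
                                      positivity)
  linarith

lemma exists_first_diff {a b : ℕ → ℕ} {L : ℕ} (h : ¬ ∀ i < L, a i = b i) :
    ∃ t < L, (∀ i < t, a i = b i) ∧ a t ≠ b t := by
  classical
  push Not at h
  refine ⟨Nat.find h, (Nat.find_spec h).1, fun i hi => ?_, (Nat.find_spec h).2⟩
  have := Nat.find_min h hi
  by_contra hne
  exact this ⟨hi.trans (Nat.find_spec h).1, hne⟩

lemma exists_first_diff_of_ne {a b : ℕ → ℕ} (h : a ≠ b) :
    ∃ t, (∀ i < t, a i = b i) ∧ a t ≠ b t := by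
  obtain ⟨n, hn⟩ := Function.ne_iff.1 h
  obtain ⟨t, -, ht⟩ := exists_first_diff (L := n + 1) fun H => hn (H n (by omega))
  exact ⟨t, ht⟩

lemma shift_le_of_unique {M : ℕ} {q : ℝ} (hq : 1 < q) (hqM : q ≤ M + 1) {d : ℕ → ℕ}
    (hd : IsExpansion M q 1 d) (huniq : ∀ e, IsExpansion M q 1 e → e = d) (n j : ℕ)
    (h : ∀ i < j, d (n + i) = d i) : d (n + j) ≤ d j := by
  have htail := fun n => tail_lt_one_of_lt hq hqM hd huniq (n := n)
  have hle : ∀ n, piQ q (fun i => d (n + i)) ≤ 1 := by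
    intro n
    induction n with
    | zero => simpa using hd.2.le
    | succ n ih =>
      rcases (hd.1 n).lt_or_eq with hn | hn
      · exact (htail n hn).le
      · have h1 := piQ_shift hq hd.1 n
        rw [hn] at h1
        nlinarith
  by_contra! hcon
  linarith [hle n,
    one_lt_piQ_of_lex_gt hq (a := fun i => d (n + i)) (fun i => hd.1 _) hd htail h hcon]

lemma exists_add_gt_of_unique {M : ℕ} {q : ℝ} (hq : 1 < q) (hqM : q ≤ M + 1) {d : ℕ → ℕ}
    (hd : IsExpansion M q 1 d) (huniq : ∀ e, IsExpansion M q 1 e → e = d) {n : ℕ} (hn : 1 ≤ n) :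
    ∃ j, (∀ i < j, d (n + i) + d i = M) ∧ M < d (n + j) + d j := by
  have htail := fun n => tail_lt_one_of_lt hq hqM hd huniq (n := n)
  have hM : 0 < M := by
    have : (0 : ℝ) < M := by linarith
    exact_mod_cast this
  have hlt : ∀ n, piQ q (fun i => M - d (n + 1 + i)) < 1 := by
    intro n
    induction n with
    | zero =>
      refine compl_tail_lt_one_of_pos hq hqM hd huniq (Nat.pos_of_ne_zero fun h0 => ?_)
      have h1 := htail 0 (by rwa [h0])
      have h2 := piQ_shift hq hd.1 0
      simp only [zero_add, h0] at h1 h2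
      rw [hd.2] at h2
      push_cast at h2
      linarith
    | succ n ih =>
      rcases Nat.eq_zero_or_pos (d (n + 1)) with h0 | h0
      · have h1 := piQ_shift hq (a := fun i => M - d i) (fun i => Nat.sub_le _ _) (n + 1)
        simp only [h0, Nat.sub_zero] at h1
        nlinarith
      · exact compl_tail_lt_one_of_pos hq hqM hd huniq h0
  obtain ⟨n, rfl⟩ := Nat.exists_eq_add_of_le' hn
  have hv := hlt n
  have hne : (fun i => M - d (n + 1 + i)) ≠ d := by
    intro h
    rw [h, hd.2] at hv
    exact lt_irrefl _ hv
  obtain ⟨t, ht, htne⟩ := exists_first_diff_of_ne hne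
  refine ⟨t, fun i hi => ?_, ?_⟩
  · have := ht i hi
    have := hd.1 (n + 1 + i)
    omega
  · by_contra! hcon
    refine absurd hv (not_lt.2 (one_lt_piQ_of_lex_gt hq (fun i => Nat.sub_le _ _) hd htail ht ?_).le)
    omega

/-! ### Sequences that are unique expansions -/

/-- The strict lexicographic condition characterising unique expansions of `1` in bases below
`M + 1`: every proper shift of `e` lies strictly between the reflection of `e` and `e`. -/
structure IsStrictlyAdmissible (M : ℕ) (e : ℕ → ℕ) : Prop where
  le : ∀ i, e i ≤ M
  shift_lt : ∀ n ≥ 1, ∃ j, (∀ i < j, e (n + i) = e i) ∧ e (n + j) < e j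
  lt_add : ∀ n ≥ 1, ∃ j, (∀ i < j, e (n + i) + e i = M) ∧ M < e (n + j) + e j

lemma piQ_shift_lt_one {M : ℕ} {q : ℝ} (hq : 1 < q) {a e : ℕ → ℕ} (ha : ∀ i, a i ≤ M)
    (he : IsExpansion M q 1 e) (hpos : ∀ n, 0 < piQ q (fun i => e (n + 1 + i)))
    (hlex : ∀ n ≥ 1, ∃ j, (∀ i < j, a (n + i) = e i) ∧ a (n + j) < e j) {n : ℕ} (hn : 1 ≤ n) :
    piQ q (fun i => a (n + i)) < 1 := by
  have hq0 : 0 < q := by linarith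
  have hstep : ∀ n ≥ 1, ∃ j, q ^ (j + 1) * (piQ q (fun i => a (n + i)) - 1) <
      piQ q (fun i => a (n + j + 1 + i)) - 1 := by
    intro n hn
    obtain ⟨j, hj, hlt⟩ := hlex n hn
    refine ⟨j, ?_⟩
    have h1 := piQ_first_diff hq (a := fun i => a (n + i)) (fun i => ha _) he.1 hj
    simp only [he.2, ← add_assoc] at h1
    have h2 : (a (n + j) : ℝ) + 1 ≤ e j := by exact_mod_cast hlt
    have h3 := hpos j
    rw [h1]
    linarith
  have hgrow : ∀ k : ℕ, ∀ n ≥ 1, 1 < piQ q (fun i => a (n + i)) →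
      q ^ k * (piQ q (fun i => a (n + i)) - 1) ≤ M / (q - 1) := by
    intro k
    induction k with
    | zero =>
      intro n _ _
      have := piQ_le hq (a := fun i => a (n + i)) fun i => ha _
      linarith
    | succ k ih =>
      intro n hn h1
      obtain ⟨j, hj⟩ := hstep n hn
      have h0 : 0 < piQ q (fun i => a (n + i)) - 1 := by linarith
      have h2 : q * (piQ q (fun i => a (n + i)) - 1) ≤
          q ^ (j + 1) * (piQ q (fun i => a (n + i)) - 1) := by
        gcongr
        exact le_self_pow₀ hq.le (by omega)
      have h3 := ih (n + j + 1) (by omega) (by nlinarith)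
      calc q ^ (k + 1) * (piQ q (fun i => a (n + i)) - 1)
          = q ^ k * (q * (piQ q (fun i => a (n + i)) - 1)) := by ring
        _ ≤ q ^ k * (piQ q (fun i => a (n + j + 1 + i)) - 1) := by gcongr; linarith
        _ ≤ _ := h3
  have hle : ∀ n ≥ 1, piQ q (fun i => a (n + i)) ≤ 1 := by
    intro n hn
    by_contra! h1
    have h0 : 0 < piQ q (fun i => a (n + i)) - 1 := by linarith
    obtain ⟨k, hk⟩ := pow_unbounded_of_one_lt (M / (q - 1) / (piQ q (fun i => a (n + i)) - 1)) hq
    rw [div_lt_iff₀ h0] at hk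
    linarith [hgrow k n hn h1]
  obtain ⟨j, hj⟩ := hstep n hn
  have h1 := hle (n + j + 1) (by omega)
  by_contra! h2
  have : 0 ≤ q ^ (j + 1) * (piQ q (fun i => a (n + i)) - 1) :=
    mul_nonneg (by positivity) (by linarith)
  linarith

lemma IsStrictlyAdmissible.unique {M : ℕ} {q : ℝ} (hq : 1 < q) {e : ℕ → ℕ}
    (h : IsStrictlyAdmissible M e) (hv : piQ q e = 1) (c : ℕ → ℕ) (hc : IsExpansion M q 1 c) :
    c = e := by
  have hpos : ∀ n, 0 < piQ q (fun i => e (n + 1 + i)) := by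
    intro n
    obtain ⟨j, -, hj⟩ := h.lt_add (n + 1) (by omega)
    have := h.le j
    exact piQ_pos hq (fun i => h.le _) (n := j) (by omega)
  have hT := fun n => piQ_shift_lt_one hq h.le ⟨h.le, hv⟩ hpos h.shift_lt (n := n)
  have hR : ∀ n, 1 ≤ n → piQ q (fun i => M - e (n + i)) < 1 := by
    intro n hn
    refine piQ_shift_lt_one hq (a := fun i => M - e i) (fun i => Nat.sub_le _ _) ⟨h.le, hv⟩ hpos
      (fun n hn => ?_) hn
    obtain ⟨j, hj, hlt⟩ := h.lt_add n hn
    refine ⟨j, fun i hi => ?_, ?_⟩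
    · have := hj i hi
      omega
    · have := h.le (n + j)
      omega
  by_contra hne
  obtain ⟨t, ht, htne⟩ := exists_first_diff_of_ne hne
  have h1 := piQ_first_diff hq hc.1 h.le ht
  rw [hc.2, hv, sub_self, mul_zero] at h1
  have hTt := hT (t + 1) (by omega)
  have hRt := hR (t + 1) (by omega)
  rw [piQ_compl hq (a := fun i => e (t + 1 + i)) fun i => h.le _] at hRt
  have h2 := piQ_nonneg hq fun i => c (t + 1 + i)
  have h3 := piQ_le hq (a := fun i => c (t + 1 + i)) fun i => hc.1 _
  rcases lt_or_gt_of_ne htne with hlt | hlt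
  · have : (c t : ℝ) + 1 ≤ e t := by exact_mod_cast hlt
    linarith
  · have : (e t : ℝ) + 1 ≤ c t := by exact_mod_cast hlt
    linarith

lemma IsStrictlyAdmissible.mem_univBases {M : ℕ} {q : ℝ} (hq : 1 < q) {e : ℕ → ℕ}
    (h : IsStrictlyAdmissible M e) (hv : piQ q e = 1) : q ∈ UnivBases M := by
  refine ⟨hq, ?_, e, ⟨h.le, hv⟩, fun c hc => h.unique hq hv c hc⟩
  have := piQ_le hq h.le
  rw [hv, le_div_iff₀ (by linarith)] at this
  linarith

/-! ### Admissible prefixes and their periodic continuations -/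

/-- No suffix of the length-`m` prefix of `d` is the reflection of a prefix of `d`; rather, each
suffix is strictly larger than the reflected prefix of the same length. -/
def IsGoodLength (M : ℕ) (d : ℕ → ℕ) (m : ℕ) : Prop :=
  ∀ k < m, ∃ j, k + j < m ∧ (∀ i < j, d (k + i) + d i = M) ∧ M < d (k + j) + d j

/-- The prefix `w` of `d` of length `m`, followed by the periodic repetition of `\overline{w}⁺`. -/
def prefixReflPeriodic (M : ℕ) (d : ℕ → ℕ) (m i : ℕ) : ℕ :=
  if i < m then d i else M - d (i % m) + if i % m + 1 = m then 1 else 0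

section Combinatorics

variable {M : ℕ} {d : ℕ → ℕ}

lemma exists_isGoodLength_ge (hle : ∀ n j, (∀ i < j, d (n + i) = d i) → d (n + j) ≤ d j)
    (hgt : ∀ n, ∃ j, (∀ i < j, d (n + i) + d i = M) ∧ M < d (n + j) + d j) (k : ℕ) :
    ∀ n, (∀ i < n, d (k + i) + d i = M) → M < d (k + n) + d n →
      ∃ m > k + n, IsGoodLength M d m := by
  induction k using Nat.strong_induction_on with
  | _ k ih =>
    intro n hn hnM
    by_cases hgood : IsGoodLength M d (k + n + 1)
    · exact ⟨_, by omega, hgood⟩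
    unfold IsGoodLength at hgood
    push Not at hgood
    obtain ⟨k', hk', hbad⟩ := hgood
    obtain ⟨n', hn', hnM'⟩ := hgt k'
    have hlong : k + n + 1 ≤ k' + n' := by
      by_contra! hcon
      exact absurd (hbad n' hcon hn') (by omega)
    rcases lt_trichotomy k' k with hlt | rfl | hlt
    · obtain ⟨m, hm, hmg⟩ := ih k' hlt n' hn' hnM'
      exact ⟨m, by omega, hmg⟩
    · have := hn' n (by omega)
      omega
    · exfalso
      have h1 := hle (k' - k) (n - (k' - k)) fun i hi => by
        have h2 := hn (k' - k + i) (by omega)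
        have h3 := hn' i (by omega)
        rw [show k + (k' - k + i) = k' + i by omega] at h2
        omega
      have h3 := hn' (n - (k' - k)) (by omega)
      rw [show k' + (n - (k' - k)) = k + n by omega] at h3
      rw [show k' - k + (n - (k' - k)) = n by omega] at h1
      omega

lemma exists_isGoodLength (hle : ∀ n j, (∀ i < j, d (n + i) = d i) → d (n + j) ≤ d j)
    (hgt : ∀ n ≥ 1, ∃ j, (∀ i < j, d (n + i) + d i = M) ∧ M < d (n + j) + d j) (N : ℕ) :
    ∃ m > N, IsGoodLength M d m := by
  have hd0 : ∀ n, d n ≤ d 0 := fun n => by simpa using hle n 0 (by simp)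
  have hgt' : ∀ n, ∃ j, (∀ i < j, d (n + i) + d i = M) ∧ M < d (n + j) + d j := by
    intro n
    rcases Nat.eq_zero_or_pos n with rfl | hn
    · obtain ⟨j, -, hj⟩ := hgt 1 le_rfl
      have := hd0 j
      have := hd0 (1 + j)
      exact ⟨0, by simp, by simp only [add_zero]; omega⟩
    · exact hgt n hn
  obtain ⟨n, hn, hnM⟩ := hgt' N
  obtain ⟨m, hm, hmg⟩ := exists_isGoodLength_ge hle hgt' N n hn hnM
  exact ⟨m, by omega, hmg⟩

lemma prefixReflPeriodic_of_lt {m i : ℕ} (hi : i < m) : prefixReflPeriodic M d m i = d i := by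
  simp [prefixReflPeriodic, hi]

lemma prefixReflPeriodic_add (hdM : ∀ i, d i ≤ M) {m a i : ℕ} (ha : 1 ≤ a) (hi : i < m) :
    prefixReflPeriodic M d m (a * m + i) + d i = M + if i + 1 = m then 1 else 0 := by
  have h1 : ¬ a * m + i < m := by nlinarith
  have h2 : (a * m + i) % m = i := by
    rw [add_comm, Nat.add_mul_mod_self_right, Nat.mod_eq_of_lt hi]
  have := hdM i
  simp only [prefixReflPeriodic, h1, h2, if_false]
  omega

lemma prefixReflPeriodic_le_succ (hdM : ∀ i, d i ≤ M) (m i : ℕ) :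
    prefixReflPeriodic M d m i ≤ M + 1 := by
  have := hdM i
  unfold prefixReflPeriodic
  split_ifs <;> omega

lemma prefixReflPeriodic_lt_shift (hdM : ∀ i, d i ≤ M) {m : ℕ} (hm : IsGoodLength M d m) {a j : ℕ}
    (ha : 1 ≤ a) (hj : 1 ≤ j) (hjm : j < m) :
    ∃ t, (∀ i < t, prefixReflPeriodic M d m (a * m + i) = prefixReflPeriodic M d m (j + i)) ∧
      prefixReflPeriodic M d m (a * m + t) < prefixReflPeriodic M d m (j + t) := by
  obtain ⟨t, htm, ht, hlt⟩ := hm j hjm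
  refine ⟨t, fun i hi => ?_, ?_⟩
  · have h1 := prefixReflPeriodic_add hdM ha (m := m) (i := i) (by omega)
    rw [if_neg (by omega)] at h1
    rw [prefixReflPeriodic_of_lt (by omega : j + i < m)]
    have := ht i hi
    omega
  · have h1 := prefixReflPeriodic_add hdM ha (m := m) (i := t) (by omega)
    rw [if_neg (by omega)] at h1
    rw [prefixReflPeriodic_of_lt htm]
    omega

lemma IsGoodLength.isStrictlyAdmissible (hdM : ∀ i, d i ≤ M)
    (hle : ∀ n j, (∀ i < j, d (n + i) = d i) → d (n + j) ≤ d j) {m : ℕ} (hm2 : 2 ≤ m)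
    (hm : IsGoodLength M d m) : IsStrictlyAdmissible M (prefixReflPeriodic M d m) := by
  have hd0 : ∀ n, d n ≤ d 0 := fun n => by simpa using hle n 0 (by simp)
  have hlt := fun i => prefixReflPeriodic_of_lt (M := M) (d := d) (m := m) (i := i)
  have hadd := fun a i => prefixReflPeriodic_add hdM (m := m) (a := a) (i := i)
  have hK := fun a j => prefixReflPeriodic_lt_shift hdM hm (a := a) (j := j)
  set e := prefixReflPeriodic M d m
  have hsplit : ∀ n, ∃ a k, k < m ∧ n = a * m + k := fun n =>
    ⟨n / m, n % m, Nat.mod_lt _ (by omega), (Nat.div_add_mod' n m).symm⟩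
  constructor
  · intro i
    obtain ⟨a, k, hk, rfl⟩ := hsplit i
    rcases Nat.eq_zero_or_pos a with rfl | ha
    · rw [zero_mul, zero_add, hlt k hk]
      exact hdM k
    · have h1 := hadd a k ha hk
      split_ifs at h1 with hkm
      · obtain ⟨j, hjm, -, hj⟩ := hm k hk
        obtain rfl : j = 0 := by omega
        have := hdM 0
        simp only [add_zero] at hj
        omega
      · omega
  · intro n hn
    obtain ⟨a, k, hk, rfl⟩ := hsplit n
    rcases Nat.eq_zero_or_pos a with rfl | ha
    · simp only [zero_mul, zero_add] at hn ⊢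
      by_cases hall : ∀ i < m - k, d (k + i) = d i
      · obtain ⟨t, ht, htlt⟩ := hK 1 (m - k) le_rfl (by omega) (by omega)
        refine ⟨m - k + t, fun i hi => ?_, ?_⟩
        · by_cases him : i < m - k
          · rw [hlt _ (by omega), hlt _ (by omega), hall i him]
          · have := ht (i - (m - k)) (by omega)
            rwa [show 1 * m + (i - (m - k)) = k + i by omega,
              show m - k + (i - (m - k)) = i by omega] at this
        · rwa [show 1 * m + t = k + (m - k + t) by omega] at htlt
      · obtain ⟨t, htm, ht, htne⟩ := exists_first_diff hall
        refine ⟨t, fun i hi => ?_, ?_⟩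
        · rw [hlt _ (by omega), hlt _ (by omega), ht i hi]
        · rw [hlt _ (by omega), hlt _ (by omega)]
          exact lt_of_le_of_ne (hle k t ht) htne
    · rcases Nat.eq_zero_or_pos k with rfl | hk0
      · refine ⟨0, by simp, ?_⟩
        have h1 := hadd a 0 ha hk
        rw [if_neg (by omega)] at h1
        obtain ⟨j, -, -, hj⟩ := hm 0 hk
        have := hd0 j
        rw [zero_add] at hj
        rw [hlt 0 hk]
        simp only [add_zero] at h1 ⊢
        omega
      · obtain ⟨t, htm, ht, htlt⟩ := hm k hk
        have hpre : ∀ i < t, e (a * m + k + i) = e i := by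
          intro i hi
          have h1 := hadd a (k + i) ha (by omega)
          rw [if_neg (by omega), ← add_assoc] at h1
          rw [hlt i (by omega)]
          have := ht i hi
          omega
        have h1 := hadd a (k + t) ha htm
        rw [← add_assoc] at h1
        have h2 := hlt t (by omega)
        by_cases hlast : e (a * m + k + t) < e t
        · exact ⟨t, hpre, hlast⟩
        · have hkt : k + t + 1 = m := by
            by_contra hne
            rw [if_neg hne] at h1
            omega
          rw [if_pos hkt] at h1
          obtain ⟨s, hs, hslt⟩ := hK (a + 1) (t + 1) (by omega) (by omega) (by omega)
          have hm' : (a + 1) * m = a * m + k + (t + 1) := by rw [add_mul]; omega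
          rw [hm'] at hs hslt
          refine ⟨t + 1 + s, fun i hi => ?_, by rwa [← add_assoc]⟩
          rcases lt_trichotomy i t with hit | rfl | hit
          · exact hpre i hit
          · omega
          · have := hs (i - (t + 1)) (by omega)
            rwa [add_assoc, show t + 1 + (i - (t + 1)) = i by omega] at this
  · intro n hn
    obtain ⟨a, k, hk, rfl⟩ := hsplit n
    rcases Nat.eq_zero_or_pos a with rfl | ha
    · simp only [zero_mul, zero_add]
      obtain ⟨t, htm, ht, htlt⟩ := hm k hk
      refine ⟨t, fun i hi => ?_, ?_⟩
      · rw [hlt _ (by omega), hlt _ (by omega), ht i hi]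
      · rwa [hlt _ (by omega), hlt _ (by omega)]
    · have hval : ∀ i, k + i < m → e (a * m + k + i) + d (k + i) =
          M + if k + i + 1 = m then 1 else 0 := fun i hi => by
        rw [add_assoc]
        exact hadd a (k + i) ha hi
      by_cases hall : ∀ i < m - k - 1, d (k + i) = d i
      · refine ⟨m - k - 1, fun i hi => ?_, ?_⟩
        · have h1 := hval i (by omega)
          rw [if_neg (by omega), hall i hi] at h1
          rwa [hlt i (by omega)]
        · have h1 := hval (m - k - 1) (by omega)
          rw [if_pos (by omega)] at h1
          have h2 := hle k (m - k - 1) hall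
          rw [hlt (m - k - 1) (by omega)]
          omega
      · obtain ⟨t, htm, ht, htne⟩ := exists_first_diff hall
        refine ⟨t, fun i hi => ?_, ?_⟩
        · have h1 := hval i (by omega)
          rw [if_neg (by omega), ht i hi] at h1
          rwa [hlt i (by omega)]
        · have h1 := hval t (by omega)
          rw [if_neg (by omega)] at h1
          have h2 := hle k t ht
          rw [hlt t (by omega)]
          omega

lemma prefixReflPeriodic_ne (hdM : ∀ i, d i ≤ M)
    (hle : ∀ n j, (∀ i < j, d (n + i) = d i) → d (n + j) ≤ d j) {m m' : ℕ} (hm : 1 ≤ m)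
    (hmm : m < m') (h : prefixReflPeriodic M d m = d) : prefixReflPeriodic M d m' ≠ d := by
  intro h'
  have h1 : ∀ i < m, d (m' + i) + d i = M := by
    intro i hi
    have := prefixReflPeriodic_add hdM (m := m') (a := 1) (i := i) le_rfl (by omega)
    rwa [h', if_neg (by omega), one_mul] at this
  have hk : m' % m < m := Nat.mod_lt _ hm
  have ha : 1 ≤ m' / m := (Nat.one_le_div_iff hm).2 hmm.le
  have h2 : ∀ i, m' % m + i < m → d (m' + i) + d (m' % m + i) =
      M + if m' % m + i + 1 = m then 1 else 0 := by
    intro i hi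
    have := prefixReflPeriodic_add hdM ha hi
    rwa [h, ← add_assoc, Nat.div_add_mod'] at this
  have h3 := hle (m' % m) (m - m' % m - 1) fun i hi => by
    have h4 := h1 i (by omega)
    have h5 := h2 i (by omega)
    rw [if_neg (by omega)] at h5
    omega
  have h4 := h1 (m - m' % m - 1) (by omega)
  have h5 := h2 (m - m' % m - 1) (by omega)
  rw [if_pos (by omega)] at h5
  omega

end Combinatorics

/-! ### Univoque bases are not isolated -/

lemma exists_univBases_near {M : ℕ} {q : ℝ} (hqU : q ∈ UnivBases M) {ε : ℝ} (hε : 0 < ε) :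
    ∃ r ∈ UnivBases M, r ≠ q ∧ |r - q| < ε := by
  obtain ⟨hq, hqM, d, hd, huniq⟩ := hqU
  have hle := shift_le_of_unique hq hqM hd huniq
  have hgt := fun n => exists_add_gt_of_unique hq hqM hd huniq (n := n)
  obtain ⟨j, -, hj⟩ := hgt 1 le_rfl
  have hd0 : 0 < d j := by have := hd.1 (1 + j); omega
  obtain ⟨s, hs, hsq⟩ : ∃ s, max 1 (q - ε) < s ∧ s < q :=
    exists_between (max_lt hq (by linarith))
  obtain ⟨hs1, hsε⟩ := max_lt_iff.1 hs
  obtain ⟨u, hqu, huε⟩ : ∃ u, q < u ∧ u < q + ε := exists_between (by linarith)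
  have hlow : 1 < piQ s d := hd.2 ▸ piQ_lt_piQ hs1 hsq hd.1 hd0
  have hhigh : piQ u d < 1 := hd.2 ▸ piQ_lt_piQ hq hqu hd.1 hd0
  have hconv := fun {x : ℝ} (hx : 1 < x) => tendsto_piQ hx (e := prefixReflPeriodic M d)
    (prefixReflPeriodic_le_succ hd.1) fun m i => prefixReflPeriodic_of_lt
  obtain ⟨N, hN⟩ := eventually_atTop.1 (((hconv hs1).eventually (lt_mem_nhds hlow)).and
    ((hconv (hq.trans hqu)).eventually (gt_mem_nhds hhigh)))
  obtain ⟨m, hmN, hm2, hm, hne⟩ : ∃ m, N ≤ m ∧ 2 ≤ m ∧ IsGoodLength M d m ∧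
      prefixReflPeriodic M d m ≠ d := by
    obtain ⟨m, hm, hmg⟩ := exists_isGoodLength hle hgt (N + 2)
    obtain ⟨m', hm', hmg'⟩ := exists_isGoodLength hle hgt m
    by_cases h : prefixReflPeriodic M d m = d
    · exact ⟨m', by omega, by omega, hmg',
        prefixReflPeriodic_ne hd.1 hle (by omega) hm' h⟩
    · exact ⟨m, by omega, by omega, hmg, h⟩
  have hadm := hm.isStrictlyAdmissible hd.1 hle hm2
  obtain ⟨hN1, hN2⟩ := hN m hmN
  obtain ⟨r, ⟨hsr, hru⟩, hr⟩ := intermediate_value_Icc' (hsq.trans hqu).le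
    ((continuousOn_piQ hs1 hadm.le).mono Icc_subset_Ici_self) ⟨hN2.le, hN1.le⟩
  refine ⟨r, hadm.mem_univBases (hs1.trans_le hsr) hr, ?_, ?_⟩
  · rintro rfl
    exact hne (huniq _ ⟨hadm.le, hr⟩)
  · rw [abs_lt]
    constructor <;> linarith

/-- The set `U` of univoque bases has no isolated points, and neither does its
closure. -/
theorem stmt9 (M : ℕ) (hM : 0 < M) :
    (∀ q ∈ UnivBases M, ∀ ε > (0 : ℝ),
      ∃ r ∈ UnivBases M, r ≠ q ∧ |r - q| < ε) ∧
    (∀ q ∈ closure (UnivBases M), ∀ ε > (0 : ℝ),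
      ∃ r ∈ closure (UnivBases M), r ≠ q ∧ |r - q| < ε) := by
  refine ⟨fun q hq ε hε => exists_univBases_near hq hε, fun q hq ε hε => ?_⟩
  by_cases hqU : q ∈ UnivBases M
  · obtain ⟨r, hr, h⟩ := exists_univBases_near hqU hε
    exact ⟨r, subset_closure hr, h⟩
  · obtain ⟨r, hr, hqr⟩ := Metric.mem_closure_iff.1 hq ε hε
    refine ⟨r, subset_closure hr, fun h => hqU (h ▸ hr), ?_⟩
    rwa [dist_comm, Real.dist_eq] at hqr

end
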